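/- arXiv:1105.4322 — 3 statements merged into one kernel-verified Lean document; each statement's English description precedes it below -/
import Mathlib

section
/- Let G be a finite simple connected bipartite graph with n edges and let K be a field. Then the toric ideal I_{(A_{G̃})^±} ⊆ K[x_1,…,x_{2n+1}] is generated by quadratic binomials (i.e. by elements m_1 − m_2 with m_1, m_2 monomials of degree 2) if and only if every cycle of G of length ≥ 6 has a chord. -/
/-- The centrally symmetric configuration `A^± ∈ ℤ^{(d+1)×(2n+1)}` of `A ∈ ℤ^{d×n}`:
its columns are `(0,…,0,1)ᵀ` (column `0`), `(a_j, 1)ᵀ` (columns `1,…,n`) and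
`(−a_j, 1)ᵀ` (columns `n+1,…,2n`). -/
def csc {d n : ℕ} (A : Matrix (Fin d) (Fin n) ℤ) :
    Matrix (Fin (d + 1)) (Fin (2 * n + 1)) ℤ := fun i j =>
  if hi : (i : ℕ) < d then
    if h0 : (j : ℕ) = 0 then 0
    else if hj : (j : ℕ) ≤ n then A ⟨i, hi⟩ ⟨(j : ℕ) - 1, by omega⟩
    else - A ⟨i, hi⟩ ⟨(j : ℕ) - n - 1, by have := j.isLt; omega⟩
  else 1

/-- The matrix `A_{G̃} ∈ ℤ^{d×n}` of a graph with edges `{v k, w k}` (`v k < w k`):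
its `k`-th column is `μ(e_k) = 𝐞_{v k} − 𝐞_{w k}`. -/
def dirEdgeMatrix {d n : ℕ} (v w : Fin n → Fin d) : Matrix (Fin d) (Fin n) ℤ :=
  Matrix.of fun i k => (if i = v k then (1 : ℤ) else 0) - (if i = w k then 1 else 0)

/-- The toric ideal `I_M ⊆ K[x_1,…,x_m]` of an integer matrix `M ∈ ℤ^{D×m}`: the
kernel of the `K`-algebra map to the Laurent polynomial ring (the group algebra of
`ℤ^D`) sending `x_j` to the Laurent monomial `t^{b_j}` given by the `j`-th column
`b_j` of `M`. -/
noncomputable def toricIdeal (K : Type*) [Field K] {D m : ℕ}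
    (M : Matrix (Fin D) (Fin m) ℤ) : Ideal (MvPolynomial (Fin m) K) :=
  RingHom.ker (MvPolynomial.aeval
    (fun j => (AddMonoidAlgebra.single (fun i => M i j) 1 :
      AddMonoidAlgebra K (Fin D → ℤ))) :
    MvPolynomial (Fin m) K →ₐ[K] AddMonoidAlgebra K (Fin D → ℤ))

namespace CscQuad

open SimpleGraph

section Algebra

variable {A V : Type*} [CommRing A]

/-- The relation `∏ R = ∏ B` between two products, homogenized by powers of `z`. -/
def Balanced (z : A) (X : V × V → A) (R B : Multiset (V × V)) : Prop :=
  z ^ (B.card - R.card) * (R.map X).prod = z ^ (R.card - B.card) * (B.map X).prod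

variable {z : A} {X : V × V → A} {R₁ B₁ R₂ B₂ : Multiset (V × V)}

theorem Balanced.symm (h : Balanced z X R₁ B₁) : Balanced z X B₁ R₁ :=
  Eq.symm h

theorem Balanced.eq_of_card_eq {s : ℕ} (h : Balanced z X R₁ B₁)
    (hs : R₁.card = B₁.card + s) : (R₁.map X).prod = z ^ s * (B₁.map X).prod := by
  simpa [Balanced, hs] using h

theorem balanced_of_card_eq {s : ℕ} (hs : R₁.card = B₁.card + s)
    (h : (R₁.map X).prod = z ^ s * (B₁.map X).prod) : Balanced z X R₁ B₁ := by
  simpa [Balanced, hs] using h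

/-- Adding two relations with opposite excess, the middle factor `g` being cancelled. -/
theorem balanced_add_aux {s t : ℕ} {g : A}
    (h₁ : (R₁.map X).prod = z ^ s * ((B₁.map X).prod * g))
    (h₂ : (B₂.map X).prod = z ^ t * (g * (R₂.map X).prod))
    (hc : R₁.card + R₂.card + t = B₁.card + B₂.card + s) :
    Balanced z X (R₁ + R₂) (B₁ + B₂) := by
  obtain hst | hst := le_total t s
  · obtain ⟨q, rfl⟩ := Nat.exists_eq_add_of_le hst
    apply balanced_of_card_eq (s := q) (by simp only [Multiset.card_add]; omega)
    simp only [Multiset.map_add, Multiset.prod_add, h₁, h₂]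
    ring
  · obtain ⟨q, rfl⟩ := Nat.exists_eq_add_of_le hst
    apply Balanced.symm
    apply balanced_of_card_eq (s := q) (by simp only [Multiset.card_add]; omega)
    simp only [Multiset.map_add, Multiset.prod_add, h₁, h₂]
    ring

theorem Balanced.add (h₁ : Balanced z X R₁ B₁) (h₂ : Balanced z X R₂ B₂) :
    Balanced z X (R₁ + R₂) (B₁ + B₂) := by
  wlog hle : B₁.card ≤ R₁.card generalizing R₁ B₁ R₂ B₂
  · exact (this h₁.symm h₂.symm (by omega)).symm
  obtain ⟨s, hs⟩ := Nat.exists_eq_add_of_le hle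
  obtain h | h := le_total B₂.card R₂.card
  · obtain ⟨t, ht⟩ := Nat.exists_eq_add_of_le h
    apply balanced_of_card_eq (s := s + t) (by simp only [Multiset.card_add]; omega)
    simp only [Multiset.map_add, Multiset.prod_add, h₁.eq_of_card_eq hs, h₂.eq_of_card_eq ht]
    ring
  · obtain ⟨t, ht⟩ := Nat.exists_eq_add_of_le h
    apply balanced_add_aux (s := s) (t := t) (g := 1)
    · rw [h₁.eq_of_card_eq hs]; ring
    · rw [h₂.symm.eq_of_card_eq ht]; ring
    · omega

/-- Gluing two relations along a common factor `f`. -/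
theorem Balanced.glue {f : V × V} (h₁ : Balanced z X R₁ (f ::ₘ B₁))
    (h₂ : Balanced z X (f ::ₘ R₂) B₂) (hlt : B₁.card < R₁.card) :
    Balanced z X (R₁ + R₂) (B₁ + B₂) := by
  obtain ⟨s, hs⟩ := Nat.exists_eq_add_of_lt hlt
  have e₁ := h₁.eq_of_card_eq (s := s) (by simp only [Multiset.card_cons]; omega)
  simp only [Multiset.map_cons, Multiset.prod_cons] at e₁
  obtain h | h := le_total B₂.card (R₂.card + 1)
  · obtain ⟨t, ht⟩ := Nat.exists_eq_add_of_le h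
    have e₂ := h₂.eq_of_card_eq (s := t) (by simp only [Multiset.card_cons]; omega)
    simp only [Multiset.map_cons, Multiset.prod_cons] at e₂
    apply balanced_of_card_eq (s := s + t) (by simp only [Multiset.card_add]; omega)
    simp only [Multiset.map_add, Multiset.prod_add, e₁]
    linear_combination z ^ s * (B₁.map X).prod * e₂
  · obtain ⟨t, ht⟩ := Nat.exists_eq_add_of_le h
    have e₂ := h₂.symm.eq_of_card_eq (s := t) (by simp only [Multiset.card_cons]; omega)
    simp only [Multiset.map_cons, Multiset.prod_cons] at e₂
    apply balanced_add_aux (s := s) (t := t) (g := X f)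
    · rw [e₁]; ring
    · rw [e₂]
    · omega

end Algebra

section Walks

variable {V : Type*} {G : SimpleGraph V}

/-- A colouring of the steps of a walk, recorded as the multiset `R` of the reversed red steps
and the multiset `B` of the blue steps. -/
inductive ColoredWalk : {i j : V} → G.Walk i j → Multiset (V × V) → Multiset (V × V) → Prop
  | nil (i : V) : ColoredWalk (Walk.nil : G.Walk i i) 0 0
  | red {i k j : V} (h : G.Adj i k) {p : G.Walk k j} {R B : Multiset (V × V)} :
      ColoredWalk p R B → ColoredWalk (Walk.cons h p) ((k, i) ::ₘ R) B
  | blue {i k j : V} (h : G.Adj i k) {p : G.Walk k j} {R B : Multiset (V × V)} :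
      ColoredWalk p R B → ColoredWalk (Walk.cons h p) R ((i, k) ::ₘ B)

variable {i j k : V} {R B R₁ B₁ R₂ B₂ : Multiset (V × V)}

theorem ColoredWalk.card_add {p : G.Walk i j} (h : ColoredWalk p R B) :
    R.card + B.card = p.length := by
  induction h with
  | nil => simp
  | red h _ ih => simp only [Multiset.card_cons, Walk.length_cons]; omega
  | blue h _ ih => simp only [Multiset.card_cons, Walk.length_cons]; omega

theorem ColoredWalk.append {p : G.Walk i j} {q : G.Walk j k} (hp : ColoredWalk p R₁ B₁)
    (hq : ColoredWalk q R₂ B₂) : ColoredWalk (p.append q) (R₁ + R₂) (B₁ + B₂) := by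
  induction hp with
  | nil => simpa using hq
  | red h _ ih => simpa using ColoredWalk.red h (ih hq)
  | blue h _ ih => simpa using ColoredWalk.blue h (ih hq)

theorem ColoredWalk.of_append {p : G.Walk i j} {q : G.Walk j k}
    (h : ColoredWalk (p.append q) R B) :
    ∃ R₁ B₁ R₂ B₂, ColoredWalk p R₁ B₁ ∧ ColoredWalk q R₂ B₂ ∧ R = R₁ + R₂ ∧ B = B₁ + B₂ := by
  induction p generalizing R B with
  | nil => exact ⟨0, 0, R, B, .nil _, by simpa using h, by simp⟩
  | cons ha p ih =>
    rw [Walk.cons_append] at h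
    cases h with
    | red _ h =>
      obtain ⟨R₁, B₁, R₂, B₂, h₁, h₂, rfl, rfl⟩ := ih h
      exact ⟨_, _, _, _, .red ha h₁, h₂, by simp⟩
    | blue _ h =>
      obtain ⟨R₁, B₁, R₂, B₂, h₁, h₂, rfl, rfl⟩ := ih h
      exact ⟨_, _, _, _, .blue ha h₁, h₂, by simp⟩

theorem exists_append_append {p : G.Walk i j} {a b : ℕ} (hab : a ≤ b) (hb : b ≤ p.length)
    {x y : V} (hx : p.getVert a = x) (hy : p.getVert b = y) :
    ∃ (q₁ : G.Walk i x) (q₂ : G.Walk x y) (q₃ : G.Walk y j),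
      p = q₁.append (q₂.append q₃) ∧ q₁.length = a ∧ q₂.length = b - a ∧
        q₃.length = p.length - b := by
  have split : ∀ {i j : V} (p : G.Walk i j) (a : ℕ) (x : V), a ≤ p.length → p.getVert a = x →
      ∃ (q₁ : G.Walk i x) (q₂ : G.Walk x j), p = q₁.append q₂ ∧ q₁.length = a ∧
        q₂.length = p.length - a := by
    rintro i j p a x ha rfl
    exact ⟨p.take a, p.drop a, by simp, by simp [ha], by simp⟩
  obtain ⟨q₁, q, rfl, h₁, hq⟩ := split p a x (by omega) hx
  rw [Walk.length_append] at hq hb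
  obtain ⟨q₂, q₃, rfl, h₂, h₃⟩ := split q (b - a) y (by omega) (by
    rw [← hy, Walk.getVert_append, if_neg (by omega), h₁])
  exact ⟨q₁, q₂, q₃, rfl, h₁, h₂, by simp only [Walk.length_append] at *; omega⟩

end Walks

section Cycle

variable {A V : Type*} [CommRing A] {G : SimpleGraph V}

/-- The quadratic relations between the images of the variables `x_0 = z`, `x_(i,j) = X (i, j)`. -/
structure QuadRel (G : SimpleGraph V) (z : A) (X : V × V → A) : Prop where
  inv : ∀ i j, G.Adj i j → X (i, j) * X (j, i) = z * z
  path : ∀ i j k l, G.Adj i j → G.Adj j k → G.Adj i l → G.Adj l k →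
    X (i, j) * X (j, k) = X (i, l) * X (l, k)
  swap : ∀ i j k l, G.Adj i j → G.Adj k l → G.Adj i l → G.Adj k j →
    X (i, j) * X (k, l) = X (i, l) * X (k, j)

variable {z : A} {X : V × V → A} {R B : Multiset (V × V)}

theorem QuadRel.balanced_two (hX : QuadRel G z X) {a b : V} (h : G.Adj a b) (h' : G.Adj b a)
    (hc : ColoredWalk (.cons h (.cons h' .nil)) R B) : Balanced z X R B := by
  have e := hX.inv a b h
  cases hc with
  | red _ hc => cases hc with
    | red _ hc => cases hc; simp [Balanced]; linear_combination e
    | blue _ hc => cases hc; simp [Balanced]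
  | blue _ hc => cases hc with
    | red _ hc => cases hc; simp [Balanced]
    | blue _ hc => cases hc; simp [Balanced]; linear_combination -e

theorem QuadRel.balanced_four (hX : QuadRel G z X) {a b c d : V} (h₁ : G.Adj a b)
    (h₂ : G.Adj b c) (h₃ : G.Adj c d) (h₄ : G.Adj d a)
    (hc : ColoredWalk (.cons h₁ (.cons h₂ (.cons h₃ (.cons h₄ .nil)))) R B) :
    Balanced z X R B := by
  have i₁ := hX.inv a b h₁
  have i₂ := hX.inv b c h₂
  have i₃ := hX.inv c d h₃
  have i₄ := hX.inv d a h₄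
  have p₁ := hX.path a b c d h₁ h₂ h₄.symm h₃.symm
  have p₂ := hX.path b c d a h₂ h₃ h₁.symm h₄.symm
  have p₃ := hX.path c d a b h₃ h₄ h₂.symm h₁.symm
  have p₄ := hX.path d a b c h₄ h₁ h₃.symm h₂.symm
  have s₁ := hX.swap a b c d h₁ h₃ h₄.symm h₂.symm
  have s₂ := hX.swap b c d a h₂ h₄ h₁.symm h₃.symm
  rcases hc with _ | ⟨_, hc⟩ | ⟨_, hc⟩ <;> rcases hc with _ | ⟨_, hc⟩ | ⟨_, hc⟩ <;>
  rcases hc with _ | ⟨_, hc⟩ | ⟨_, hc⟩ <;> rcases hc with _ | ⟨_, hc⟩ | ⟨_, hc⟩ <;>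
  cases hc <;> simp [Balanced]
  all_goals grind

/-- Every coloured closed walk gives a relation, if long cycles have chords. -/
theorem QuadRel.balanced_of_closed (hX : QuadRel G z X) (hbip : G.Colorable 2)
    (hch : ∀ (a : V) (p : G.Walk a a), p.IsCycle → 6 ≤ p.length →
      ∃ x y : V, x ∈ p.support ∧ y ∈ p.support ∧ G.Adj x y ∧ s(x, y) ∉ p.edges)
    {a : V} (p : G.Walk a a) (hp : ColoredWalk p R B) : Balanced z X R B := by
  have even : ∀ {a : V} (p : G.Walk a a), Even p.length := by
    intro a p
    have c : G.Coloring Bool := hbip.toColoring (by simp)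
    exact (c.even_length_iff_congr p).2 Iff.rfl
  induction hn : p.length using Nat.strong_induction_on generalizing a R B with
  | _ n ih =>
  subst hn
  by_cases h6 : 6 ≤ p.length
  · by_cases hcyc : p.IsCycle
    · obtain ⟨x, y, hx, hy, hxy, hne⟩ := hch a p hcyc h6
      rw [Walk.mem_support_iff_exists_getVert] at hx hy
      obtain ⟨m, hmx, hm⟩ := hx
      obtain ⟨l, hly, hl⟩ := hy
      wlog hml : m ≤ l generalizing x y m l
      · exact this y x hxy.symm (by rwa [Sym2.eq_swap]) l hly hl m hmx hm (by omega)
      rw [Walk.mk_mem_edges_iff_exists] at hne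
      push Not at hne
      have hml' : m ≠ l := by
        rintro rfl
        exact hxy.ne (hmx.symm.trans hly)
      have hs : m + 1 ≠ l := by
        rintro rfl
        exact hne m (by omega) (by rw [hmx, hly])
      have h0 : ¬ (m = 0 ∧ l = p.length) := by
        rintro ⟨rfl, rfl⟩
        rw [Walk.getVert_zero] at hmx
        rw [Walk.getVert_length] at hly
        exact hxy.ne (hmx.symm.trans hly)
      have h1 : ¬ (m = 0 ∧ l + 1 = p.length) := by
        rintro ⟨rfl, h⟩
        refine hne l (by omega) ?_
        rw [h, Walk.getVert_length, hly, ← hmx, Walk.getVert_zero, Sym2.eq_swap]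
      have h2 : ¬ (m = 1 ∧ l = p.length) := by
        rintro ⟨rfl, rfl⟩
        refine hne 0 (by omega) ?_
        rw [← hmx, ← hly, Walk.getVert_length, Walk.getVert_zero, Sym2.eq_swap]
      obtain ⟨q₁, q₂, q₃, rfl, l₁, l₂, l₃⟩ := exists_append_append hml hl hmx hly
      obtain ⟨R₁, B₁, R', B', c₁, c', rfl, rfl⟩ := hp.of_append
      obtain ⟨R₂, B₂, R₃, B₃, c₂, c₃, rfl, rfl⟩ := c'.of_append
      have c₃₁ := c₃.append c₁
      have key : Balanced z X (R₂ + (R₃ + R₁)) (B₂ + (B₃ + B₁)) := by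
        have hodd := even (Walk.cons hxy.symm q₂)
        rw [Walk.length_cons, ← c₂.card_add] at hodd
        have lt₁ : (Walk.cons hxy.symm q₂).length <
            (q₁.append (q₂.append q₃)).length := by
          simp only [Walk.length_append, Walk.length_cons] at *; omega
        have lt₂ : (Walk.cons hxy (q₃.append q₁)).length <
            (q₁.append (q₂.append q₃)).length := by
          simp only [Walk.length_append, Walk.length_cons] at *; omega
        obtain h | h | h := lt_trichotomy B₂.card R₂.card
        · exact (ih _ lt₁ _ (.blue hxy.symm c₂) rfl).glue (ih _ lt₂ _ (.red hxy c₃₁) rfl) h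
        · rw [h] at hodd
          exact absurd hodd (by simp [parity_simps])
        · exact ((ih _ lt₁ _ (.red hxy.symm c₂) rfl).symm.glue
            (ih _ lt₂ _ (.blue hxy c₃₁) rfl).symm h).symm
      convert key using 1 <;> abel
    · have hpath : ¬ p.tail.IsPath := fun h =>
        hcyc (Walk.isCycle_iff_isPath_tail_and_le_length.2 ⟨h, by omega⟩)
      have htl : p.tail.length + 1 = p.length :=
        Walk.length_tail_add_one (by rw [← Walk.length_eq_zero_iff]; omega)
      have hinj : ∃ m l, m < l ∧ l ≤ p.length ∧ 0 < m ∧ p.getVert m = p.getVert l := by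
        rw [← Walk.IsPath.getVert_injOn_iff] at hpath
        simp only [Set.InjOn, not_forall] at hpath
        obtain ⟨m, hm, l, hl, h, hne⟩ := hpath
        simp only [Set.mem_ofPred_eq] at hm hl
        rw [Walk.getVert_tail, Walk.getVert_tail] at h
        obtain h' | h' := lt_or_gt_of_ne hne
        · exact ⟨m + 1, l + 1, by omega, by omega, by omega, h⟩
        · exact ⟨l + 1, m + 1, by omega, by omega, by omega, h.symm⟩
      obtain ⟨m, l, hml, hl, hm, heq⟩ := hinj
      obtain ⟨x, hx⟩ : ∃ x, p.getVert l = x := ⟨_, rfl⟩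
      obtain ⟨q₁, q₂, q₃, rfl, l₁, l₂, l₃⟩ :=
        exists_append_append hml.le hl (heq.trans hx) hx
      obtain ⟨R₁, B₁, R', B', c₁, c', rfl, rfl⟩ := hp.of_append
      obtain ⟨R₂, B₂, R₃, B₃, c₂, c₃, rfl, rfl⟩ := c'.of_append
      have c₁₃ := c₁.append c₃
      have lt₁ : q₂.length < (q₁.append (q₂.append q₃)).length := by
        simp only [Walk.length_append] at *; omega
      have lt₂ : (q₁.append q₃).length < (q₁.append (q₂.append q₃)).length := by
        simp only [Walk.length_append] at *; omega
      have key := (ih _ lt₁ _ c₂ rfl).add (ih _ lt₂ _ c₁₃ rfl)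
      convert key using 1 <;> abel
  · have hev := even p
    clear ih even
    match p, hp with
    | .nil, hp => cases hp; simp [Balanced]
    | .cons _ .nil, _ => simp at hev
    | .cons _ (.cons _ .nil), hp => exact hX.balanced_two _ _ hp
    | .cons _ (.cons _ (.cons _ .nil)), _ => simp [parity_simps] at hev
    | .cons _ (.cons _ (.cons _ (.cons _ .nil))), hp => exact hX.balanced_four _ _ _ _ hp
    | .cons _ (.cons _ (.cons _ (.cons _ (.cons _ .nil)))), _ => simp [parity_simps] at hev
    | .cons _ (.cons _ (.cons _ (.cons _ (.cons _ (.cons _ _))))), _ =>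
      exact absurd h6 (by simp only [Walk.length_cons]; omega)

end Cycle
section Connect

variable {A V : Type*} [CommRing A] [DecidableEq V] {G : SimpleGraph V}

/-- The sum of the vectors `𝐞_i − 𝐞_j` over a multiset of arcs `(i, j)`. -/
def divergence (U : Multiset (V × V)) : V → ℤ :=
  (U.map fun e => (Pi.single e.1 1 - Pi.single e.2 1 : V → ℤ)).sum

@[simp]
theorem divergence_zero : divergence (0 : Multiset (V × V)) = 0 := rfl

@[simp]
theorem divergence_cons (e : V × V) (U : Multiset (V × V)) :
    divergence (e ::ₘ U) = Pi.single e.1 1 - Pi.single e.2 1 + divergence U := by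
  simp [divergence]

@[simp]
theorem divergence_add (U W : Multiset (V × V)) :
    divergence (U + W) = divergence U + divergence W := by
  simp [divergence]

theorem exists_tail_of_divergence_pos {U : Multiset (V × V)} {i : V} (h : 0 < divergence U i) :
    ∃ k, (i, k) ∈ U := by
  induction U using Multiset.induction with
  | empty => simp at h
  | cons e U ih =>
    by_cases hU : 0 < divergence U i
    · obtain ⟨k, hk⟩ := ih hU
      exact ⟨k, Multiset.mem_cons_of_mem hk⟩
    · by_cases hi : i = e.1
      · exact ⟨e.2, by simp [hi]⟩
      · simp only [divergence_cons, Pi.add_apply, Pi.sub_apply, Pi.single_apply, if_neg hi] at h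
        split_ifs at h <;> omega

theorem exists_head_of_divergence_neg {U : Multiset (V × V)} {i : V} (h : divergence U i < 0) :
    ∃ k, (k, i) ∈ U := by
  induction U using Multiset.induction with
  | empty => simp at h
  | cons e U ih =>
    by_cases hU : divergence U i < 0
    · obtain ⟨k, hk⟩ := ih hU
      exact ⟨k, Multiset.mem_cons_of_mem hk⟩
    · by_cases hi : i = e.2
      · exact ⟨e.1, by simp [hi]⟩
      · simp only [divergence_cons, Pi.add_apply, Pi.sub_apply, Pi.single_apply, if_neg hi] at h
        split_ifs at h <;> omega

theorem ColoredWalk.divergence_add {i j : V} {p : G.Walk i j} {R B : Multiset (V × V)}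
    (h : ColoredWalk p R B) :
    divergence B + Pi.single j 1 = divergence R + Pi.single i 1 := by
  induction h with
  | nil => rfl
  | red h _ ih => rw [divergence_cons, add_right_comm, add_assoc, ih]; simp only; abel
  | blue h _ ih => rw [divergence_cons, add_assoc, ih]; simp only; abel

theorem exists_closed_of_walk {U W : Multiset (V × V)} (hU : ∀ e ∈ U, G.Adj e.1 e.2)
    (hW : ∀ e ∈ W, G.Adj e.1 e.2) (hd : divergence U = divergence W)
    {i j : V} (p : G.Walk i j) {R B : Multiset (V × V)} (hp : ColoredWalk p R B)
    (hlen : 0 < p.length) (hR : R ≤ W) (hB : B ≤ U) :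
    ∃ (a : V) (q : G.Walk a a) (R' B' : Multiset (V × V)), ColoredWalk q R' B' ∧
      0 < q.length ∧ R' ≤ W ∧ B' ≤ U := by
  induction hn : W.card + U.card - p.length using Nat.strong_induction_on
    generalizing i j R B with
  | _ n ih =>
  by_cases hij : i = j
  · subst hij
    exact ⟨i, p, R, B, hp, hlen, hR, hB⟩
  have hd' := congrFun hp.divergence_add i
  obtain ⟨U', rfl⟩ := Multiset.le_iff_exists_add.1 hB
  obtain ⟨W', rfl⟩ := Multiset.le_iff_exists_add.1 hR
  have hd'' := congrFun hd i
  simp only [CscQuad.divergence_add, Pi.add_apply, Pi.single_apply, if_neg hij, if_true]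
    at hd' hd''
  have hcard := hp.card_add
  have hcases : divergence U' i < 0 ∨ 0 < divergence W' i := by omega
  obtain h | h := hcases
  · obtain ⟨k, hk⟩ := exists_head_of_divergence_neg h
    have hadj : G.Adj k i := hU (k, i) (Multiset.mem_add.2 (.inr hk))
    have hc := Multiset.card_pos_iff_exists_mem.2 ⟨_, hk⟩
    refine ih _ ?_ (.cons hadj p) (.blue hadj hp) (by simp) hR ?_ rfl
    · simp only [Walk.length_cons, Multiset.card_add] at *
      omega
    · obtain ⟨T, rfl⟩ := Multiset.exists_cons_of_mem hk
      rw [Multiset.add_cons]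
      exact Multiset.cons_le_cons _ (Multiset.le_add_right _ _)
  · obtain ⟨k, hk⟩ := exists_tail_of_divergence_pos h
    have hadj : G.Adj i k := hW (i, k) (Multiset.mem_add.2 (.inr hk))
    have hc := Multiset.card_pos_iff_exists_mem.2 ⟨_, hk⟩
    refine ih _ ?_ (.cons hadj.symm p) (.red hadj.symm hp) (by simp) ?_ hB rfl
    · simp only [Walk.length_cons, Multiset.card_add] at *
      omega
    · obtain ⟨T, rfl⟩ := Multiset.exists_cons_of_mem hk
      rw [Multiset.add_cons]
      exact Multiset.cons_le_cons _ (Multiset.le_add_right _ _)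

theorem exists_closed {U W : Multiset (V × V)} (hU : ∀ e ∈ U, G.Adj e.1 e.2)
    (hW : ∀ e ∈ W, G.Adj e.1 e.2) (hd : divergence U = divergence W)
    (hne : 0 < W.card + U.card) :
    ∃ (a : V) (q : G.Walk a a) (R B : Multiset (V × V)), ColoredWalk q R B ∧
      0 < q.length ∧ R ≤ W ∧ B ≤ U := by
  obtain h | h : 0 < W.card ∨ 0 < U.card := by omega
  · obtain ⟨⟨i, j⟩, he⟩ := Multiset.card_pos_iff_exists_mem.1 h
    exact exists_closed_of_walk hU hW hd _ (.red (hW _ he).symm (.nil _)) (by simp)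
      (by simpa using he) (by simp)
  · obtain ⟨⟨i, j⟩, he⟩ := Multiset.card_pos_iff_exists_mem.1 h
    exact exists_closed_of_walk hU hW hd _ (.blue (hU _ he) (.nil _)) (by simp)
      (by simp) (by simpa using he)

/-- Monomials in the same fibre agree modulo the quadratic relations. -/
theorem QuadRel.prod_eq_prod {z : A} {X : V × V → A} (hX : QuadRel G z X) (hbip : G.Colorable 2)
    (hch : ∀ (a : V) (p : G.Walk a a), p.IsCycle → 6 ≤ p.length →
      ∃ x y : V, x ∈ p.support ∧ y ∈ p.support ∧ G.Adj x y ∧ s(x, y) ∉ p.edges)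
    {s t : ℕ} {U W : Multiset (V × V)} (hU : ∀ e ∈ U, G.Adj e.1 e.2)
    (hW : ∀ e ∈ W, G.Adj e.1 e.2) (hd : divergence U = divergence W)
    (hc : s + U.card = t + W.card) :
    z ^ s * (U.map X).prod = z ^ t * (W.map X).prod := by
  induction hn : U.card + W.card using Nat.strong_induction_on generalizing s t U W with
  | _ n ih =>
  by_cases h0 : U.card + W.card = 0
  · have hU0 : U = 0 := Multiset.card_eq_zero.1 (by omega)
    have hW0 : W = 0 := Multiset.card_eq_zero.1 (by omega)
    subst hU0 hW0
    simp only [Multiset.card_zero, add_zero] at hc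
    simp [hc]
  obtain ⟨a, q, R, B, hq, hlen, hR, hB⟩ := exists_closed hU hW hd (by omega)
  have hbal := hX.balanced_of_closed hbip hch q hq
  have hqd := hq.divergence_add
  have hcard := hq.card_add
  obtain ⟨U', rfl⟩ := Multiset.le_iff_exists_add.1 hB
  obtain ⟨W', rfl⟩ := Multiset.le_iff_exists_add.1 hR
  rw [divergence_add, divergence_add, add_right_cancel hqd] at hd
  have hd' := add_left_cancel hd
  have hU' : ∀ e ∈ U', G.Adj e.1 e.2 := fun e he => hU e (Multiset.mem_add.2 (.inr he))
  have hW' : ∀ e ∈ W', G.Adj e.1 e.2 := fun e he => hW e (Multiset.mem_add.2 (.inr he))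
  simp only [Multiset.card_add] at hc hn
  simp only [Multiset.map_add, Multiset.prod_add]
  obtain h | h := le_total B.card R.card
  · obtain ⟨m, hm⟩ := Nat.exists_eq_add_of_le h
    have := ih _ (by omega) (s := s) (t := t + m) hU' hW' hd' (by omega) rfl
    rw [hbal.eq_of_card_eq hm]
    linear_combination (B.map X).prod * this
  · obtain ⟨m, hm⟩ := Nat.exists_eq_add_of_le h
    have := ih _ (by omega) (s := s + m) (t := t) hU' hW' hd' (by omega) rfl
    rw [hbal.symm.eq_of_card_eq hm]
    linear_combination (R.map X).prod * this

end Connect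

section Toric

open MvPolynomial

variable {K : Type*} [Field K] {D m : ℕ}

/-- The exponent of `t` in the image of the monomial with exponent `u`. -/
noncomputable def weight (M : Matrix (Fin D) (Fin m) ℤ) : (Fin m →₀ ℕ) →+ (Fin D → ℤ) :=
  Finsupp.liftAddHom fun j => (multiplesHom _ (fun i => M i j))

@[simp]
theorem weight_single (M : Matrix (Fin D) (Fin m) ℤ) (j : Fin m) :
    weight M (Finsupp.single j 1) = M.transpose j := by
  simp only [weight, Finsupp.liftAddHom_apply_single, multiplesHom_apply, one_smul]
  rfl

theorem aeval_monomial_eq_single (M : Matrix (Fin D) (Fin m) ℤ) (u : Fin m →₀ ℕ) (c : K) :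
    (aeval (fun j => (AddMonoidAlgebra.single (fun i => M i j) 1 :
      AddMonoidAlgebra K (Fin D → ℤ)))) (monomial u c) =
    AddMonoidAlgebra.single (weight M u) c := by
  have h : ∀ u : Fin m →₀ ℕ, (u.prod fun j k => (AddMonoidAlgebra.single (fun i => M i j) 1 :
      AddMonoidAlgebra K (Fin D → ℤ)) ^ k) = AddMonoidAlgebra.single (weight M u) 1 := by
    intro u
    induction u using Finsupp.induction_linear with
    | zero => simp [AddMonoidAlgebra.one_def]
    | add f g hf hg =>
      rw [Finsupp.prod_add_index' (by simp) (by simp [pow_add]), hf, hg,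
        AddMonoidAlgebra.single_mul_single, map_add, one_mul]
    | single j k =>
      rw [Finsupp.prod_single_index (by simp), AddMonoidAlgebra.single_pow]
      simp [weight]
  rw [aeval_monomial, h, ← Algebra.smul_def]
  simp

theorem monomial_sub_mem_toricIdeal_iff (M : Matrix (Fin D) (Fin m) ℤ) {u u' : Fin m →₀ ℕ} :
    monomial u (1 : K) - monomial u' 1 ∈ toricIdeal K M ↔ weight M u = weight M u' := by
  rw [toricIdeal, RingHom.mem_ker, map_sub, aeval_monomial_eq_single,
    aeval_monomial_eq_single, sub_eq_zero]
  constructor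
  · intro h
    by_contra hne
    have := DFunLike.congr_fun (congrArg AddMonoidAlgebra.coeff h) (weight M u)
    simp [Ne.symm hne] at this
  · intro h
    rw [h]

theorem toricIdeal_le (M : Matrix (Fin D) (Fin m) ℤ) (Q : Ideal (MvPolynomial (Fin m) K))
    (h : ∀ u u' : Fin m →₀ ℕ, weight M u = weight M u' →
      monomial u (1 : K) - monomial u' 1 ∈ Q) : toricIdeal K M ≤ Q := by
  intro f hf
  rw [toricIdeal, RingHom.mem_ker] at hf
  let L : AddMonoidAlgebra K (Fin D → ℤ) →ₗ[K] MvPolynomial (Fin m) K :=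
    (Finsupp.lsum K fun b => MvPolynomial.monomial (Function.invFun (weight M) b)).comp
      (AddMonoidAlgebra.coeffLinearEquiv K).toLinearMap
  have key : ∀ f : MvPolynomial (Fin m) K, f - L (aeval (fun j =>
      (AddMonoidAlgebra.single (fun i => M i j) 1 : AddMonoidAlgebra K (Fin D → ℤ))) f) ∈ Q := by
    intro f
    induction f using MvPolynomial.induction_on' with
    | monomial u a =>
      rw [aeval_monomial_eq_single]
      have hL : L (AddMonoidAlgebra.single (weight M u) a) =
          monomial (Function.invFun (weight M) (weight M u)) a := by
        simp [L]
      rw [hL]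
      have := Q.mul_mem_left (C a) (h u (Function.invFun (weight M) (weight M u))
        (Function.invFun_eq ⟨u, rfl⟩).symm)
      simpa [mul_sub, C_mul_monomial] using this
    | add p q hp hq =>
      rw [map_add, map_add, add_sub_add_comm]
      exact Q.add_mem hp hq
  have := key f
  rwa [hf, map_zero, sub_zero] at this

theorem X_mul_X_sub_mem_toricIdeal_iff (M : Matrix (Fin D) (Fin m) ℤ) {j₁ j₂ j₃ j₄ : Fin m} :
    (X j₁ * X j₂ - X j₃ * X j₄ : MvPolynomial (Fin m) K) ∈ toricIdeal K M ↔
      M.transpose j₁ + M.transpose j₂ = M.transpose j₃ + M.transpose j₄ := by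
  simp only [X, monomial_mul, one_mul]
  rw [monomial_sub_mem_toricIdeal_iff]
  simp

end Toric

section Arcs

variable {d n m : ℕ}

/-- The vector `(𝐞_i − 𝐞_j, 1)`. -/
def arcVec (i j : Fin d) : Fin (d + 1) → ℤ :=
  Fin.snoc (α := fun _ => ℤ) (Pi.single i 1 - Pi.single j 1) 1

/-- The columns of `M` are, without repetition, the vectors `(0, 1)` (at `o`) and
`(𝐞_i − 𝐞_j, 1)` for the pairs of adjacent vertices `i, j`. -/
structure IsArcMatrix (G : SimpleGraph (Fin d)) (M : Matrix (Fin (d + 1)) (Fin m) ℤ)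
    (o : Fin m) : Prop where
  origin : ∀ i, M.transpose o = arcVec i i
  cases : ∀ J, ∃ i j, (i = j ∨ G.Adj i j) ∧ M.transpose J = arcVec i j
  exists_col : ∀ i j, G.Adj i j → ∃ J, M.transpose J = arcVec i j
  inj : Function.Injective M.transpose

theorem arcVec_add_left (i j k l : Fin d) :
    arcVec i j + arcVec j k = arcVec i l + arcVec l k := by
  ext t
  cases t using Fin.lastCases <;> simp [arcVec]

theorem arcVec_add_swap (i j k l : Fin d) :
    arcVec i j + arcVec k l = arcVec i l + arcVec k j := by
  ext t
  cases t using Fin.lastCases <;> simp [arcVec]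
  ring

theorem arcVec_inj {i j k l : Fin d} (hij : i ≠ j) (h : arcVec i j = arcVec k l) :
    i = k ∧ j = l := by
  have hi := congrFun h i.castSucc
  have hj := congrFun h j.castSucc
  simp only [arcVec, Fin.snoc_castSucc, Pi.sub_apply, Pi.single_apply, if_neg hij,
    if_neg hij.symm, if_true] at hi hj
  constructor <;> by_contra hne
  · rw [if_neg hne] at hi
    split_ifs at hi <;> omega
  · rw [if_neg hne] at hj
    split_ifs at hj <;> omega

theorem arcVec_add_eq {a b a' b' x y x' y' : Fin d} (h : [a, b, a', b'].Nodup)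
    (he : arcVec a b + arcVec a' b' = arcVec x y + arcVec x' y') :
    (x = a ∧ y = b ∧ x' = a' ∧ y' = b') ∨ (x = a' ∧ y = b' ∧ x' = a ∧ y' = b) ∨
      (x = a ∧ y = b' ∧ x' = a' ∧ y' = b) ∨ (x = a' ∧ y = b ∧ x' = a ∧ y' = b') := by
  have h₁ := congrFun he a.castSucc
  have h₂ := congrFun he b.castSucc
  have h₃ := congrFun he a'.castSucc
  have h₄ := congrFun he b'.castSucc
  simp only [arcVec, Fin.snoc_castSucc, Pi.add_apply, Pi.sub_apply, Pi.single_apply]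
    at h₁ h₂ h₃ h₄
  simp only [List.nodup_cons, List.mem_cons, List.not_mem_nil, or_false, not_or] at h
  obtain ⟨⟨n₁, n₂, n₃⟩, ⟨n₄, n₅⟩, n₆, -⟩ := h
  simp only [if_true, if_neg n₁, if_neg n₂, if_neg n₃, if_neg n₄, if_neg n₅, if_neg n₆,
    if_neg (Ne.symm n₁), if_neg (Ne.symm n₂), if_neg (Ne.symm n₃), if_neg (Ne.symm n₄),
    if_neg (Ne.symm n₅), if_neg (Ne.symm n₆)] at h₁ h₂ h₃ h₄
  have k₁ : a = x ∨ a = x' := by split_ifs at h₁ <;> omega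
  have k₂ : b = y ∨ b = y' := by split_ifs at h₂ <;> omega
  have k₃ : a' = x ∨ a' = x' := by split_ifs at h₃ <;> omega
  have k₄ : b' = y ∨ b' = y' := by split_ifs at h₄ <;> omega
  clear h₁ h₂ h₃ h₄ he
  grind

theorem isArcMatrix_csc {G : SimpleGraph (Fin d)}
    {v w : Fin n → Fin d} (hlt : ∀ k, v k < w k) (hadj : ∀ k, G.Adj (v k) (w k))
    (hsurj : ∀ i j : Fin d, G.Adj i j →
      ∃ k, (v k = i ∧ w k = j) ∨ (v k = j ∧ w k = i))
    (hinj : Function.Injective fun k => (v k, w k)) [Nonempty (Fin d)] :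
    IsArcMatrix G (csc (dirEdgeMatrix v w)) 0 := by
  have h₀ : ∀ i, (csc (dirEdgeMatrix v w)).transpose 0 = arcVec i i := by
    intro i
    ext t
    cases t using Fin.lastCases <;> simp [arcVec, csc]
  have h₁ : ∀ k : Fin n, (csc (dirEdgeMatrix v w)).transpose ⟨k + 1, by omega⟩ =
      arcVec (v k) (w k) := by
    intro k
    ext t
    cases t using Fin.lastCases <;> simp [arcVec, csc, dirEdgeMatrix, Pi.single_apply]
  have h₂ : ∀ k : Fin n, (csc (dirEdgeMatrix v w)).transpose ⟨n + k + 1, by omega⟩ =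
      arcVec (w k) (v k) := by
    intro k
    ext t
    cases t using Fin.lastCases with
    | last => simp [arcVec, csc]
    | cast t =>
      have e : n + (k : ℕ) + 1 - n - 1 = k := by omega
      simp [arcVec, csc, dirEdgeMatrix, Pi.single_apply, e]
  have hJ : ∀ J : Fin (2 * n + 1), J = 0 ∨ (∃ k : Fin n, J = ⟨k + 1, by omega⟩) ∨
      ∃ k : Fin n, J = ⟨n + k + 1, by omega⟩ := by
    intro J
    obtain h | h := Nat.eq_zero_or_pos J.1
    · exact .inl (Fin.ext h)
    obtain h' | h' := le_or_gt J.1 n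
    · exact .inr (.inl ⟨⟨J.1 - 1, by omega⟩, Fin.ext (by simp only; omega)⟩)
    · exact .inr (.inr ⟨⟨J.1 - n - 1, by omega⟩, Fin.ext (by simp only; omega)⟩)
  have hne : ∀ k, v k ≠ w k := fun k => (hlt k).ne
  refine ⟨h₀, ?_, ?_, ?_⟩
  · intro J
    obtain rfl | ⟨k, rfl⟩ | ⟨k, rfl⟩ := hJ J
    · exact ⟨Classical.arbitrary _, _, .inl rfl, h₀ _⟩
    · exact ⟨_, _, .inr (hadj k), h₁ k⟩
    · exact ⟨_, _, .inr (hadj k).symm, h₂ k⟩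
  · intro i j hij
    obtain ⟨k, ⟨rfl, rfl⟩ | ⟨rfl, rfl⟩⟩ := hsurj i j hij
    · exact ⟨_, h₁ k⟩
    · exact ⟨_, h₂ k⟩
  · intro J J' h
    obtain rfl | ⟨k, rfl⟩ | ⟨k, rfl⟩ := hJ J <;> obtain rfl | ⟨l, rfl⟩ | ⟨l, rfl⟩ := hJ J'
    · rfl
    · rw [h₀ (v l), h₁] at h
      have := arcVec_inj (hne l) h.symm
      exact absurd this.2 (hne l).symm
    · rw [h₀ (v l), h₂] at h
      have := arcVec_inj (hne l).symm h.symm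
      exact absurd this.1 (hne l).symm
    · rw [h₀ (v k), h₁] at h
      have := arcVec_inj (hne k) h
      exact absurd this.2 (hne k).symm
    · rw [h₁, h₁] at h
      have := arcVec_inj (hne k) h
      rw [hinj (Prod.ext this.1 this.2)]
    · rw [h₁, h₂] at h
      have := arcVec_inj (hne k) h
      have hk := hlt k
      rw [this.1, this.2] at hk
      exact absurd hk (hlt l).asymm
    · rw [h₀ (v k), h₂] at h
      have := arcVec_inj (hne k).symm h
      exact absurd this.1 (hne k).symm
    · rw [h₂, h₁] at h
      have := arcVec_inj (hne k).symm h
      have hk := hlt k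
      rw [this.1, this.2] at hk
      exact absurd hk (hlt l).asymm
    · rw [h₂, h₂] at h
      have := arcVec_inj (hne k).symm h
      rw [hinj (Prod.ext this.2 this.1)]

end Arcs

section Backward

open MvPolynomial

variable {K : Type*} [Field K] {d m : ℕ} {G : SimpleGraph (Fin d)}
  {M : Matrix (Fin (d + 1)) (Fin m) ℤ} {o : Fin m}

/-- The ideal generated by the quadratic binomials of the toric ideal. -/
noncomputable def quadraticPart (K : Type*) [Field K] (M : Matrix (Fin (d + 1)) (Fin m) ℤ) :
    Ideal (MvPolynomial (Fin m) K) :=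
  Ideal.span {f | (∃ j₁ j₂ j₃ j₄ : Fin m, f = X j₁ * X j₂ - X j₃ * X j₄) ∧ f ∈ toricIdeal K M}

theorem mk_X_mul_mk_X_eq {j₁ j₂ j₃ j₄ : Fin m}
    (h : M.transpose j₁ + M.transpose j₂ = M.transpose j₃ + M.transpose j₄) :
    Ideal.Quotient.mk (quadraticPart K M) (X j₁) * Ideal.Quotient.mk (quadraticPart K M) (X j₂) =
      Ideal.Quotient.mk (quadraticPart K M) (X j₃) *
        Ideal.Quotient.mk (quadraticPart K M) (X j₄) := by
  rw [← map_mul, ← map_mul, Ideal.Quotient.eq]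
  exact Ideal.subset_span ⟨⟨_, _, _, _, rfl⟩, (X_mul_X_sub_mem_toricIdeal_iff M).2 h⟩

/-- The image of the variable of an arc modulo the quadratic binomials. -/
noncomputable def arcVar (K : Type*) [Field K] (M : Matrix (Fin (d + 1)) (Fin m) ℤ)
    (e : Fin d × Fin d) : MvPolynomial (Fin m) K ⧸ quadraticPart K M :=
  open Classical in
  if h : ∃ J, M.transpose J = arcVec e.1 e.2 then Ideal.Quotient.mk _ (X h.choose) else 0

theorem IsArcMatrix.arcVar_eq (hM : IsArcMatrix G M o) {i j : Fin d} {J : Fin m}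
    (h : M.transpose J = arcVec i j) :
    arcVar K M (i, j) = Ideal.Quotient.mk (quadraticPart K M) (X J) := by
  have h' : ∃ J, M.transpose J = arcVec i j := ⟨J, h⟩
  rw [arcVar, dif_pos h', hM.inj (h'.choose_spec.trans h.symm)]

theorem IsArcMatrix.quadRel (hM : IsArcMatrix G M o) :
    QuadRel G (Ideal.Quotient.mk (quadraticPart K M) (X o)) (arcVar K M) where
  inv i j hij := by
    obtain ⟨J, hJ⟩ := hM.exists_col i j hij
    obtain ⟨J', hJ'⟩ := hM.exists_col j i hij.symm
    rw [hM.arcVar_eq hJ, hM.arcVar_eq hJ']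
    apply mk_X_mul_mk_X_eq
    rw [hJ, hJ', hM.origin i, arcVec_add_left i j i i]
  path i j k l hij hjk hil hlk := by
    obtain ⟨J₁, h₁⟩ := hM.exists_col i j hij
    obtain ⟨J₂, h₂⟩ := hM.exists_col j k hjk
    obtain ⟨J₃, h₃⟩ := hM.exists_col i l hil
    obtain ⟨J₄, h₄⟩ := hM.exists_col l k hlk
    rw [hM.arcVar_eq h₁, hM.arcVar_eq h₂, hM.arcVar_eq h₃, hM.arcVar_eq h₄]
    apply mk_X_mul_mk_X_eq
    rw [h₁, h₂, h₃, h₄, arcVec_add_left]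
  swap i j k l hij hkl hil hkj := by
    obtain ⟨J₁, h₁⟩ := hM.exists_col i j hij
    obtain ⟨J₂, h₂⟩ := hM.exists_col k l hkl
    obtain ⟨J₃, h₃⟩ := hM.exists_col i l hil
    obtain ⟨J₄, h₄⟩ := hM.exists_col k j hkj
    rw [hM.arcVar_eq h₁, hM.arcVar_eq h₂, hM.arcVar_eq h₃, hM.arcVar_eq h₄]
    apply mk_X_mul_mk_X_eq
    rw [h₁, h₂, h₃, h₄, arcVec_add_swap]

/-- The class of a monomial is a power of the origin times a product of arcs. -/
theorem IsArcMatrix.exists_arcs (hM : IsArcMatrix G M o) (u : Fin m →₀ ℕ) :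
    ∃ (s : ℕ) (U : Multiset (Fin d × Fin d)), (∀ e ∈ U, G.Adj e.1 e.2) ∧
      Ideal.Quotient.mk (quadraticPart K M) (monomial u 1) =
        Ideal.Quotient.mk (quadraticPart K M) (X o) ^ s * (U.map (arcVar K M)).prod ∧
      weight M u = Fin.snoc (α := fun _ => ℤ) (divergence U) ((s + U.card : ℕ) : ℤ) := by
  set P : (Fin m →₀ ℕ) → Prop := fun u =>
    ∃ (s : ℕ) (U : Multiset (Fin d × Fin d)), (∀ e ∈ U, G.Adj e.1 e.2) ∧
      Ideal.Quotient.mk (quadraticPart K M) (monomial u 1) =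
        Ideal.Quotient.mk (quadraticPart K M) (X o) ^ s * (U.map (arcVar K M)).prod ∧
      weight M u = Fin.snoc (α := fun _ => ℤ) (divergence U) ((s + U.card : ℕ) : ℤ)
  have hzero : P 0 := by
    refine ⟨0, 0, by simp, by simp, ?_⟩
    ext t
    cases t using Fin.lastCases <;> simp
  have hadd : ∀ u u', P u → P u' → P (u + u') := by
    rintro u u' ⟨s, U, hU, hu, hw⟩ ⟨s', U', hU', hu', hw'⟩
    refine ⟨s + s', U + U', ?_, ?_, ?_⟩
    · intro e he
      exact (Multiset.mem_add.1 he).elim (hU e) (hU' e)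
    · rw [show (monomial (u + u') (1 : K)) = monomial u 1 * monomial u' 1 by
        rw [monomial_mul, one_mul], map_mul, hu, hu', Multiset.map_add, Multiset.prod_add]
      ring
    · rw [map_add, hw, hw']
      ext t
      cases t using Fin.lastCases <;> simp
      ring
  have hsingle : ∀ J, P (Finsupp.single J 1) := by
    intro J
    obtain ⟨i, j, rfl | hij, hJ⟩ := hM.cases J
    · obtain rfl : J = o := hM.inj (hJ.trans (hM.origin i).symm)
      refine ⟨1, 0, by simp, by simp [X], ?_⟩
      rw [weight_single, hJ]
      ext t
      cases t using Fin.lastCases <;> simp [arcVec]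
    · refine ⟨0, {(i, j)}, by simpa using hij, ?_, ?_⟩
      · simp [hM.arcVar_eq hJ, X]
      · rw [weight_single, hJ]
        ext t
        cases t using Fin.lastCases <;> simp [arcVec, divergence]
  change P u
  induction u using Finsupp.induction_linear with
  | zero => exact hzero
  | add f g hf hg => exact hadd f g hf hg
  | single J k =>
    induction k with
    | zero => simpa using hzero
    | succ k ih =>
      rw [Finsupp.single_add]
      exact hadd _ _ ih (hsingle J)

theorem IsArcMatrix.toricIdeal_eq_quadraticPart (hM : IsArcMatrix G M o)
    (hbip : G.Colorable 2)
    (hch : ∀ (a : Fin d) (p : G.Walk a a), p.IsCycle → 6 ≤ p.length →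
      ∃ x y : Fin d, x ∈ p.support ∧ y ∈ p.support ∧ G.Adj x y ∧ s(x, y) ∉ p.edges) :
    quadraticPart K M = toricIdeal K M := by
  apply le_antisymm
  · exact Ideal.span_le.2 fun f hf => hf.2
  apply toricIdeal_le
  intro u u' h
  obtain ⟨s, U, hU, hu, hw⟩ := hM.exists_arcs (K := K) u
  obtain ⟨s', U', hU', hu', hw'⟩ := hM.exists_arcs (K := K) u'
  rw [hw, hw'] at h
  rw [← Ideal.Quotient.eq, hu, hu']
  apply hM.quadRel.prod_eq_prod hbip hch hU hU'
  · ext i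
    simpa using congrFun h i.castSucc
  · have := congrFun h (Fin.last d)
    simp only [Fin.snoc_last] at this
    exact_mod_cast this

end Backward

section Forward

open MvPolynomial

variable {K : Type*} [Field K] {d m : ℕ} {G : SimpleGraph (Fin d)}
  {M : Matrix (Fin (d + 1)) (Fin m) ℤ} {o : Fin m}

theorem coeff_eq_zero_of_mem_span {σ : Type*} {S : Set (MvPolynomial σ K)} {u : σ →₀ ℕ}
    (hS : ∀ f ∈ S, ∃ a b : σ →₀ ℕ, f = monomial a 1 - monomial b 1 ∧
      (a ≤ u → b = a) ∧ (b ≤ u → a = b)) {f : MvPolynomial σ K} (hf : f ∈ Ideal.span S) :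
    coeff u f = 0 := by
  suffices h : ∀ g : MvPolynomial σ K, coeff u (g * f) = 0 by simpa using h 1
  induction hf using Submodule.span_induction with
  | mem f hf =>
    intro g
    obtain ⟨a, b, rfl, hab, hba⟩ := hS f hf
    rw [mul_sub, coeff_sub, coeff_mul_monomial', coeff_mul_monomial']
    by_cases ha : a ≤ u
    · rw [hab ha, sub_self]
    · by_cases hb : b ≤ u
      · rw [hba hb, sub_self]
      · rw [if_neg ha, if_neg hb, sub_self]
  | zero => simp
  | add x y _ _ hx hy =>
    intro g
    rw [mul_add, coeff_add, hx, hy, add_zero]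
  | smul a x _ hx =>
    intro g
    rw [smul_eq_mul, ← mul_assoc]
    exact hx _

theorem exists_ne_of_single_add_single_le {σ : Type*} {k : ℕ} {e : ℕ → σ} {j₁ j₂ : σ}
    (h : Finsupp.single j₁ 1 + Finsupp.single j₂ 1 ≤
      ∑ i ∈ Finset.range k, Finsupp.single (e i) 1) :
    ∃ i < k, ∃ l < k, i ≠ l ∧ e i = j₁ ∧ e l = j₂ := by
  classical
  have hu : ∀ j, (∑ i ∈ Finset.range k, Finsupp.single (e i) 1 : σ →₀ ℕ) j =
      ((Finset.range k).filter fun i => e i = j).card := by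
    intro j
    rw [Finsupp.finsetSum_apply, Finset.card_filter]
    simp [Finsupp.single_apply]
  have h₁ := h j₁
  have h₂ := h j₂
  rw [hu] at h₁ h₂
  by_cases hj : j₁ = j₂
  · subst hj
    simp only [Finsupp.add_apply, Finsupp.single_eq_same] at h₁
    obtain ⟨i, hi, l, hl, hne⟩ := Finset.one_lt_card.1 (show 1 < _ from h₁)
    simp only [Finset.mem_filter, Finset.mem_range] at hi hl
    exact ⟨i, hi.1, l, hl.1, hne, hi.2, hl.2⟩
  · simp only [Finsupp.add_apply, Finsupp.single_eq_same] at h₁ h₂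
    have h₁' : 0 < ((Finset.range k).filter fun i => e i = j₁).card := by omega
    have h₂' : 0 < ((Finset.range k).filter fun i => e i = j₂).card := by omega
    obtain ⟨i, hi⟩ := Finset.card_pos.1 h₁'
    obtain ⟨l, hl⟩ := Finset.card_pos.1 h₂'
    simp only [Finset.mem_filter, Finset.mem_range] at hi hl
    refine ⟨i, hi.1, l, hl.1, ?_, hi.2, hl.2⟩
    rintro rfl
    exact hj (hi.2.symm.trans hl.2)

/-- A closed vertex sequence of length `2 * k`, injective on a period, such that no edge joins an
even vertex to an odd one except the edges of the sequence itself. -/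
structure IsInducedEvenCycle (G : SimpleGraph (Fin d)) (k : ℕ) (c : ℕ → Fin d) : Prop where
  three_le : 3 ≤ k
  closed : c (2 * k) = c 0
  inj : ∀ i < 2 * k, ∀ j < 2 * k, c i = c j → i = j
  adj : ∀ i < 2 * k, G.Adj (c i) (c (i + 1))
  chordless : ∀ i < k, ∀ l < k, G.Adj (c (2 * i)) (c (2 * l + 1)) →
    l = i ∨ l + 1 = i ∨ (i = 0 ∧ l + 1 = k)

theorem IsArcMatrix.single_add_single_eq {k : ℕ} {c : ℕ → Fin d} (hM : IsArcMatrix G M o)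
    (hc : IsInducedEvenCycle G k c) {i l : ℕ} (hi : i < k) (hl : l < k) (hil : i ≠ l)
    {j₁ j₂ j₃ j₄ : Fin m} (h₁ : M.transpose j₁ = arcVec (c (2 * i)) (c (2 * i + 1)))
    (h₂ : M.transpose j₂ = arcVec (c (2 * l)) (c (2 * l + 1)))
    (h : M.transpose j₁ + M.transpose j₂ = M.transpose j₃ + M.transpose j₄) :
    Finsupp.single j₃ 1 + Finsupp.single j₄ 1 =
      (Finsupp.single j₁ 1 + Finsupp.single j₂ 1 : Fin m →₀ ℕ) := by
  have hne : ∀ a < 2 * k, ∀ b < 2 * k, a ≠ b → c a ≠ c b := fun a ha b hb hab h =>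
    hab (hc.inj a ha b hb h)
  have hnodup : [c (2 * i), c (2 * i + 1), c (2 * l), c (2 * l + 1)].Nodup := by
    have := hne (2 * i) (by omega) (2 * i + 1) (by omega) (by omega)
    have := hne (2 * i) (by omega) (2 * l) (by omega) (by omega)
    have := hne (2 * i) (by omega) (2 * l + 1) (by omega) (by omega)
    have := hne (2 * i + 1) (by omega) (2 * l) (by omega) (by omega)
    have := hne (2 * i + 1) (by omega) (2 * l + 1) (by omega) (by omega)
    have := hne (2 * l) (by omega) (2 * l + 1) (by omega) (by omega)
    simp [*]
  have hcross : G.Adj (c (2 * i)) (c (2 * l + 1)) → G.Adj (c (2 * l)) (c (2 * i + 1)) →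
      False := by
    intro ha hb
    have := hc.chordless i hi l hl ha
    have := hc.chordless l hl i hi hb
    have := hc.three_le
    omega
  have hil' := hne (2 * i) (by omega) (2 * l + 1) (by omega) (by omega)
  have hli' := hne (2 * l) (by omega) (2 * i + 1) (by omega) (by omega)
  obtain ⟨x, y, hxy, h₃⟩ := hM.cases j₃
  obtain ⟨x', y', hxy', h₄⟩ := hM.cases j₄
  rw [h₁, h₂, h₃, h₄] at h
  obtain ⟨rfl, rfl, rfl, rfl⟩ | ⟨rfl, rfl, rfl, rfl⟩ | ⟨rfl, rfl, rfl, rfl⟩ |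
    ⟨rfl, rfl, rfl, rfl⟩ := arcVec_add_eq hnodup h
  · rw [hM.inj (h₁.trans h₃.symm), hM.inj (h₂.trans h₄.symm)]
  · rw [hM.inj (h₁.trans h₄.symm), hM.inj (h₂.trans h₃.symm), add_comm]
  · exact (hcross (hxy.resolve_left hil') (hxy'.resolve_left hli')).elim
  · exact (hcross (hxy'.resolve_left hil') (hxy.resolve_left hli')).elim

theorem sum_arcVec_eq {k : ℕ} {c : ℕ → Fin d} (hc : c (2 * k) = c 0) :
    ∑ i ∈ Finset.range k, arcVec (c (2 * i)) (c (2 * i + 1)) =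
      ∑ i ∈ Finset.range k, arcVec (c (2 * i + 2)) (c (2 * i + 1)) := by
  rw [← sub_eq_zero, ← Finset.sum_sub_distrib]
  calc _ = ∑ i ∈ Finset.range k,
        (arcVec (c (2 * i)) (c 0) - arcVec (c (2 * (i + 1))) (c 0)) := by
        refine Finset.sum_congr rfl fun i _ => ?_
        rw [sub_eq_sub_iff_add_eq_add]
        exact arcVec_add_swap _ _ _ _
    _ = 0 := by
        rw [Finset.sum_range_sub' fun i => arcVec (c (2 * i)) (c 0), hc, mul_zero, sub_self]

theorem IsArcMatrix.span_ne_toricIdeal {k : ℕ} {c : ℕ → Fin d} (hM : IsArcMatrix G M o)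
    (hc : IsInducedEvenCycle G k c) {S : Set (MvPolynomial (Fin m) K)}
    (hS : ∀ f ∈ S, ∃ j₁ j₂ j₃ j₄ : Fin m, f = X j₁ * X j₂ - X j₃ * X j₄) :
    Ideal.span S ≠ toricIdeal K M := by
  intro hspan
  have hk := hc.three_le
  have hex : ∀ i, ∃ J, i < k → M.transpose J = arcVec (c (2 * i)) (c (2 * i + 1)) := by
    intro i
    by_cases hi : i < k
    · obtain ⟨J, hJ⟩ := hM.exists_col _ _ (hc.adj (2 * i) (by omega))
      exact ⟨J, fun _ => hJ⟩
    · exact ⟨o, fun h => absurd h hi⟩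
  have hex' : ∀ i, ∃ J, i < k → M.transpose J = arcVec (c (2 * i + 2)) (c (2 * i + 1)) := by
    intro i
    by_cases hi : i < k
    · obtain ⟨J, hJ⟩ := hM.exists_col _ _ (hc.adj (2 * i + 1) (by omega)).symm
      exact ⟨J, fun _ => hJ⟩
    · exact ⟨o, fun h => absurd h hi⟩
  choose e he using hex
  choose e' he' using hex'
  set u : Fin m →₀ ℕ := ∑ i ∈ Finset.range k, Finsupp.single (e i) 1 with hu
  set u' : Fin m →₀ ℕ := ∑ i ∈ Finset.range k, Finsupp.single (e' i) 1 with hu'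
  have hweight : weight M u = weight M u' := by
    rw [hu, hu', map_sum, map_sum]
    simp only [weight_single]
    rw [Finset.sum_congr rfl fun i hi => he i (Finset.mem_range.1 hi),
      Finset.sum_congr rfl fun i hi => he' i (Finset.mem_range.1 hi)]
    exact sum_arcVec_eq hc.closed
  have hmem : (monomial u 1 - monomial u' 1 : MvPolynomial (Fin m) K) ∈ Ideal.span S := by
    rw [hspan]
    exact (monomial_sub_mem_toricIdeal_iff M).2 hweight
  have hrigid : ∀ j₁ j₂ j₃ j₄ : Fin m,
      M.transpose j₁ + M.transpose j₂ = M.transpose j₃ + M.transpose j₄ →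
      (Finsupp.single j₁ 1 + Finsupp.single j₂ 1 : Fin m →₀ ℕ) ≤ u →
      (Finsupp.single j₃ 1 + Finsupp.single j₄ 1 : Fin m →₀ ℕ) =
        Finsupp.single j₁ 1 + Finsupp.single j₂ 1 := by
    intro j₁ j₂ j₃ j₄ h hle
    obtain ⟨i, hi, l, hl, hil, rfl, rfl⟩ := exists_ne_of_single_add_single_le hle
    exact hM.single_add_single_eq hc hi hl hil (he i hi) (he l hl) h
  have hcoeff := coeff_eq_zero_of_mem_span (u := u) (fun f hf => by
    obtain ⟨j₁, j₂, j₃, j₄, rfl⟩ := hS f hf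
    have hf' := Ideal.subset_span hf
    rw [hspan, SetLike.mem_coe, X_mul_X_sub_mem_toricIdeal_iff] at hf'
    refine ⟨_, _, ?_, hrigid _ _ _ _ hf', hrigid _ _ _ _ hf'.symm⟩
    simp only [X, monomial_mul, one_mul]) hmem
  have huu : u' = u := by
    by_contra hne
    simp [coeff_monomial, hne] at hcoeff
  have hpos : u (e' 0) ≠ 0 := by
    rw [← huu, hu', Finsupp.finsetSum_apply]
    intro h0
    rw [Finset.sum_eq_zero_iff] at h0
    simpa using h0 0 (Finset.mem_range.2 (by omega))
  apply hpos
  rw [hu, Finsupp.finsetSum_apply]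
  refine Finset.sum_eq_zero fun i hi => Finsupp.single_eq_of_ne fun hei => ?_
  have hik := Finset.mem_range.1 hi
  have hcol := he i hik
  rw [← hei, he' 0 (by omega)] at hcol
  obtain ⟨h₁, h₂⟩ := arcVec_inj (fun h => by
    have := hc.inj _ (by omega) _ (by omega) h
    omega) hcol
  have := hc.inj _ (by omega) _ (by omega) h₁
  have := hc.inj _ (by omega) _ (by omega) h₂
  omega

theorem isInducedEvenCycle_getVert (hbip : G.Colorable 2) {a : Fin d} {p : G.Walk a a}
    (hp : p.IsCycle) (h6 : 6 ≤ p.length)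
    (hno : ∀ x y : Fin d, x ∈ p.support → y ∈ p.support → G.Adj x y → s(x, y) ∈ p.edges) :
    IsInducedEvenCycle G (p.length / 2) p.getVert := by
  have heven : Even p.length := by
    have c : G.Coloring Bool := hbip.toColoring (by simp)
    exact (c.even_length_iff_congr p).2 Iff.rfl
  have hlen : 2 * (p.length / 2) = p.length := Nat.two_mul_div_two_of_even heven
  have hinj : ∀ i < p.length, ∀ j < p.length, p.getVert i = p.getVert j → i = j := by
    intro i hi j hj h
    apply hp.getVert_injOn' _ _ h <;> rw [Set.mem_ofPred_eq] <;> omega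
  have hwrap : ∀ t ≤ p.length, ∀ j < p.length, p.getVert t = p.getVert j →
      t = j ∨ (t = p.length ∧ j = 0) := by
    intro t ht j hj h
    rcases ht.lt_or_eq with ht | rfl
    · exact Or.inl (hinj t ht j hj h)
    · have h0 : p.getVert 0 = p.getVert j := p.getVert_zero.trans (p.getVert_length.symm.trans h)
      exact Or.inr ⟨rfl, (hinj 0 (by omega) j hj h0).symm⟩
  refine ⟨by omega, ?_, ?_, ?_, ?_⟩
  · rw [hlen, p.getVert_length, p.getVert_zero]
  · rwa [hlen]
  · intro i hi
    exact p.adj_getVert_succ (by omega)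
  · intro i hi l hl hadj
    obtain ⟨t, ht, hst⟩ := p.mk_mem_edges_iff_exists.1
      (hno _ _ (p.getVert_mem_support _) (p.getVert_mem_support _) hadj)
    rcases Sym2.eq_iff.1 hst with ⟨h₁, h₂⟩ | ⟨h₁, h₂⟩
    · have := hwrap t (by omega) _ (by omega) h₁
      have := hwrap (t + 1) (by omega) _ (by omega) h₂
      omega
    · have := hwrap t (by omega) _ (by omega) h₁
      have := hwrap (t + 1) (by omega) _ (by omega) h₂
      omega

end Forward

end CscQuad

/-- **Corollary 4.4 ((i) ⇔ (iv)).** Let `G` be a finite simple connected bipartite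
graph whose edges are `e_k = {v k, w k}`, `k = 1,…,n`, and let `K` be a field.  Then
the toric ideal `I_{(A_{G̃})^±}` is generated by quadratic binomials if and only if
every cycle of `G` of length at least `6` has a chord. -/
theorem toricIdeal_csc_dir_quadratic_iff (K : Type*) [Field K]
    (d n : ℕ) (G : SimpleGraph (Fin d)) (hG : G.Connected) (hbip : G.Colorable 2)
    (v w : Fin n → Fin d) (hlt : ∀ k, v k < w k)
    (hadj : ∀ k, G.Adj (v k) (w k))
    (hsurj : ∀ i j : Fin d, G.Adj i j →
      ∃ k, (v k = i ∧ w k = j) ∨ (v k = j ∧ w k = i))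
    (hinj : Function.Injective fun k => (v k, w k)) :
    (∃ S : Set (MvPolynomial (Fin (2 * n + 1)) K),
        (∀ f ∈ S, ∃ j₁ j₂ j₃ j₄ : Fin (2 * n + 1),
          f = MvPolynomial.X j₁ * MvPolynomial.X j₂ -
              MvPolynomial.X j₃ * MvPolynomial.X j₄) ∧
        Ideal.span S = toricIdeal K (csc (dirEdgeMatrix v w))) ↔
    (∀ (a : Fin d) (p : G.Walk a a), p.IsCycle → 6 ≤ p.length →
      ∃ x y : Fin d, x ∈ p.support ∧ y ∈ p.support ∧ G.Adj x y ∧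
        s(x, y) ∉ p.edges) := by
  have : Nonempty (Fin d) := hG.nonempty
  have hM := CscQuad.isArcMatrix_csc hlt hadj hsurj hinj
  constructor
  · rintro ⟨S, hS, hspan⟩ a p hp h6
    by_contra! hno
    exact hM.span_ne_toricIdeal
      (CscQuad.isInducedEvenCycle_getVert hbip hp h6 hno) hS hspan
  · intro hch
    exact ⟨_, fun f hf => hf.1, hM.toricIdeal_eq_quadraticPart hbip hch⟩
end

section
/- Let G be a finite simple connected nonbipartite graph on the vertex set {1,…,d} with n edges, let K be a field, and suppose there exists a vertex v of G contained in every odd cycle of G. Then there exists a finite simple bipartite graph G' on the vertex set {1,…,d+1} with exactly n edges such that the toric ideals coincide: I_{A_G} = I_{A_{G'}} and I_{(A_G)^±} = I_{(A_{G'})^±} (as ideals of K[x_1,…,x_n] and of K[x_1,…,x_{2n+1}] respectively, for a suitable ordering of the edges of G'). -/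
/-- The incidence matrix `A_G ∈ ℤ^{d×n}` of a graph with edges `{v k, w k}`
(`v k < w k`): its `k`-th column is `ρ(e_k) = 𝐞_{v k} + 𝐞_{w k}`. -/
def edgeMatrix {d n : ℕ} (v w : Fin n → Fin d) : Matrix (Fin d) (Fin n) ℤ :=
  Matrix.of fun i k => (if i = v k then (1 : ℤ) else 0) + (if i = w k then 1 else 0)

namespace SimpleGraph

variable {V : Type*} {G : SimpleGraph V}

theorem Walk.even_length_bypass_iff [DecidableEq V]
    (hG : ∀ (a : V) (p : G.Walk a a), p.IsCycle → Even p.length) {a b : V} (p : G.Walk a b) :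
    Even p.bypass.length ↔ Even p.length := by
  induction p with
  | nil => rfl
  | @cons u v w h p ih =>
    rw [Walk.length_cons, Nat.even_add_one, ← ih, Walk.bypass]
    split_ifs with hu
    · have hpath := (p.bypass_isPath).takeUntil hu
      have hsum : (p.bypass.takeUntil u hu).length + (p.bypass.dropUntil u hu).length
          = p.bypass.length := by
        rw [← Walk.length_append, Walk.take_spec]
      have hodd : ¬ Even (p.bypass.takeUntil u hu).length := by
        by_cases he : s(u, v) ∈ (p.bypass.takeUntil u hu).edges
        · rw [hpath.length_eq_one_of_mem_edges (Sym2.eq_swap ▸ he)]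
          decide
        · have := hG u (Walk.cons h _) ((Walk.cons_isCycle_iff _ h).mpr ⟨hpath, he⟩)
          rwa [Walk.length_cons, Nat.even_add_one] at this
      rw [← hsum, Nat.even_add]
      tauto
    · rw [Walk.length_cons, Nat.even_add_one]

/-- A graph without odd cycles is bipartite. -/
theorem colorable_two_of_forall_isCycle_even
    (hG : ∀ (a : V) (p : G.Walk a a), p.IsCycle → Even p.length) : G.Colorable 2 := by
  classical
  refine two_colorable_iff_forall_loop_even.mpr fun u w => ?_
  rw [← Walk.even_length_bypass_iff hG, (Walk.isPath_iff_nil.mp w.bypass_isPath).eq_nil]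
  exact Even.zero

/-- If a vertex lies on every odd cycle, some two-colouring of the vertices is proper away from
that vertex. -/
theorem exists_bool_coloring_away_of_mem_odd_cycles {v₀ : V}
    (hv₀ : ∀ (a : V) (p : G.Walk a a), p.IsCycle → Odd p.length → v₀ ∈ p.support) :
    ∃ c : V → Bool, ∀ a b, G.Adj a b → a ≠ v₀ → b ≠ v₀ → c a ≠ c b := by
  have hle : G.deleteIncidenceSet v₀ ≤ G := G.deleteIncidenceSet_le v₀
  have hcol : (G.deleteIncidenceSet v₀).Colorable 2 := by
    refine colorable_two_of_forall_isCycle_even fun a p hp => ?_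
    by_contra hodd
    have hmem := hv₀ a (p.mapLe hle) (hp.mapLe hle) (by simpa using hodd)
    rw [Walk.support_mapLe_eq_support] at hmem
    obtain ⟨e, he, hve⟩ := (Walk.mem_support_iff_exists_mem_edges_of_not_nil hp.not_nil).mp hmem
    have := Walk.edges_subset_edgeSet p he
    rw [edgeSet_deleteIncidenceSet] at this
    exact this.2 ⟨this.1, hve⟩
  obtain ⟨C⟩ := hcol
  refine ⟨fun a => decide (C a = 0), fun a b hab ha hb => ?_⟩
  have := C.valid ((G.deleteIncidenceSet_adj).mpr ⟨hab, ha, hb⟩)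
  simp only [ne_eq, decide_eq_decide]
  omega

end SimpleGraph

section ToricIdeal

variable {D D' d d' m n : ℕ}

theorem aeval_single_monomial (K : Type*) [Field K] (M : Matrix (Fin D) (Fin m) ℤ)
    (s : Fin m →₀ ℕ) (a : K) :
    MvPolynomial.aeval (fun j => (AddMonoidAlgebra.single (fun i => M i j) 1 :
      AddMonoidAlgebra K (Fin D → ℤ))) (MvPolynomial.monomial s a) =
      AddMonoidAlgebra.single (M.mulVec fun j => (s j : ℤ)) a := by
  rw [MvPolynomial.aeval_monomial, Finsupp.prod_fintype _ _ (fun _ => pow_zero _)]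
  simp only [AddMonoidAlgebra.single_pow, one_pow]
  have hprod : ∀ t : Finset (Fin m),
      ∏ j ∈ t, (AddMonoidAlgebra.single (s j • fun i => M i j) 1 :
        AddMonoidAlgebra K (Fin D → ℤ)) =
      AddMonoidAlgebra.single (∑ j ∈ t, s j • fun i => M i j) 1 := by
    intro t
    induction t using Finset.induction_on with
    | empty => rfl
    | insert j t hj ih =>
      rw [Finset.prod_insert hj, Finset.sum_insert hj, ih, AddMonoidAlgebra.single_mul_single,
        one_mul]
  rw [hprod, AddMonoidAlgebra.coe_algebraMap, Function.comp_apply,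
    AddMonoidAlgebra.single_mul_single, zero_add, mul_one]
  congr 1
  ext i
  simp [Matrix.mulVec, dotProduct, mul_comm]

/-- The toric ideal depends on the matrix only through its integer kernel, monotonically. -/
theorem toricIdeal_le_toricIdeal (K : Type*) [Field K] {M : Matrix (Fin D) (Fin m) ℤ}
    {M' : Matrix (Fin D') (Fin m) ℤ}
    (h : ∀ u : Fin m → ℤ, M.mulVec u = 0 → M'.mulVec u = 0) :
    toricIdeal K M ≤ toricIdeal K M' := by
  have hfac : Function.FactorsThrough (fun s : Fin m → ℤ => M'.mulVec s) (fun s => M.mulVec s) := by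
    intro s t hst
    have := h (s - t) (by rw [Matrix.mulVec_sub]; exact sub_eq_zero.mpr hst)
    rw [Matrix.mulVec_sub] at this
    exact sub_eq_zero.mp this
  obtain ⟨f, hf⟩ := (Function.factorsThrough_iff _).mp hfac
  intro p hp
  rw [toricIdeal, RingHom.mem_ker] at hp ⊢
  suffices H : ∀ q : MvPolynomial (Fin m) K,
      MvPolynomial.aeval (fun j => (AddMonoidAlgebra.single (fun i => M' i j) 1 :
        AddMonoidAlgebra K (Fin D' → ℤ))) q =
      AddMonoidAlgebra.mapDomain f (MvPolynomial.aeval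
        (fun j => (AddMonoidAlgebra.single (fun i => M i j) 1 :
          AddMonoidAlgebra K (Fin D → ℤ))) q) by
    have hp' := H p
    erw [hp] at hp'
    rw [AddMonoidAlgebra.mapDomain_zero] at hp'
    exact hp'
  intro q
  induction q using MvPolynomial.induction_on' with
  | monomial s a =>
    rw [aeval_single_monomial, aeval_single_monomial, AddMonoidAlgebra.mapDomain_single]
    exact congrArg (AddMonoidAlgebra.single · a) (congrFun hf _)
  | add p q hp hq => rw [map_add, map_add, AddMonoidAlgebra.mapDomain_add, hp, hq]

theorem toricIdeal_congr (K : Type*) [Field K] {M : Matrix (Fin D) (Fin m) ℤ}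
    {M' : Matrix (Fin D') (Fin m) ℤ}
    (h : ∀ u : Fin m → ℤ, M.mulVec u = 0 ↔ M'.mulVec u = 0) :
    toricIdeal K M = toricIdeal K M' :=
  le_antisymm (toricIdeal_le_toricIdeal K fun u => (h u).mp)
    (toricIdeal_le_toricIdeal K fun u => (h u).mpr)

/-- The matrix `(0 | 1 | -1)` through which the non-constant rows of `csc A` factor. -/
def signedColumns (n : ℕ) : Matrix (Fin n) (Fin (2 * n + 1)) ℤ := fun k j =>
  if (j : ℕ) = k + 1 then 1 else if (j : ℕ) = n + k + 1 then -1 else 0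

theorem csc_castSucc (A : Matrix (Fin d) (Fin n) ℤ) (i : Fin d) (j : Fin (2 * n + 1)) :
    csc A i.castSucc j = (A * signedColumns n) i j := by
  have hj := j.isLt
  rw [Matrix.mul_apply]
  simp only [csc, signedColumns, Fin.val_castSucc, i.isLt, dif_pos]
  split_ifs with h0 h1
  · refine (Finset.sum_eq_zero fun k _ => ?_).symm
    rw [if_neg (by omega), if_neg (by omega), mul_zero]
  · rw [Finset.sum_eq_single ⟨(j : ℕ) - 1, by omega⟩]
    · rw [if_pos (by simp only; omega), mul_one]
    · intro k _ hk
      rw [ne_eq, Fin.ext_iff] at hk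
      simp only at hk
      rw [if_neg (by omega), if_neg (by omega), mul_zero]
    · simp
  · rw [Finset.sum_eq_single ⟨(j : ℕ) - n - 1, by omega⟩]
    · rw [if_neg (by simp only; omega), if_pos (by simp only; omega), mul_neg_one]
    · intro k _ hk
      rw [ne_eq, Fin.ext_iff] at hk
      simp only at hk
      rw [if_neg (by omega), if_neg (by omega), mul_zero]
    · simp

theorem csc_mulVec_eq_zero_iff (A : Matrix (Fin d) (Fin n) ℤ) (u : Fin (2 * n + 1) → ℤ) :
    (csc A).mulVec u = 0 ↔ A.mulVec ((signedColumns n).mulVec u) = 0 ∧ ∑ j, u j = 0 := by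
  rw [funext_iff, Fin.forall_fin_succ', Matrix.mulVec_mulVec, funext_iff]
  have hrow : ∀ i : Fin d, (csc A).mulVec u i.castSucc = (A * signedColumns n).mulVec u i :=
    fun i => by simp only [Matrix.mulVec, dotProduct, csc_castSucc]
  have hlast : (csc A).mulVec u (Fin.last d) = ∑ j, u j := by
    simp [Matrix.mulVec, dotProduct, csc]
  simp only [hrow, hlast, Pi.zero_apply]

theorem toricIdeal_csc_congr (K : Type*) [Field K] {M : Matrix (Fin d) (Fin n) ℤ}
    {M' : Matrix (Fin d') (Fin n) ℤ}
    (h : ∀ u : Fin n → ℤ, M.mulVec u = 0 ↔ M'.mulVec u = 0) :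
    toricIdeal K (csc M) = toricIdeal K (csc M') :=
  toricIdeal_congr K fun u => by rw [csc_mulVec_eq_zero_iff, csc_mulVec_eq_zero_iff, h]

end ToricIdeal

section VertexSplitting

variable {d n : ℕ}

/-- If colours `c` take opposite values at the ends of every edge, the rows of the edge matrix
satisfy the relation with signs given by the colours. -/
theorem sum_sign_mul_edgeMatrix_eq_zero {v w : Fin n → Fin d} {c : Fin d → Bool}
    (hc : ∀ k, c (v k) ≠ c (w k)) (k : Fin n) :
    ∑ i, (if c i then (1 : ℤ) else -1) * edgeMatrix v w i k = 0 := by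
  simp only [edgeMatrix, Matrix.of_apply, mul_add, mul_ite, mul_one, mul_zero,
    Finset.sum_add_distrib, Finset.sum_ite_eq', Finset.mem_univ, if_true]
  have := hc k
  cases hv : c (v k) <;> cases hw : c (w k) <;> simp_all

/-- Merging two vertices of a bipartite graph that have opposite colours keeps the kernel of the
edge matrix: here `v₀` and the last vertex are merged into `v₀`. -/
theorem edgeMatrix_mulVec_eq_zero_iff_of_merge {v w : Fin n → Fin d}
    {v' w' : Fin n → Fin (d + 1)} {c' : Fin (d + 1) → Bool} {v₀ : Fin d}
    (hc' : ∀ k, c' (v' k) ≠ c' (w' k)) (hlast : c' (Fin.last d) ≠ c' v₀.castSucc)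
    (hne : ∀ i, i ≠ v₀ → ∀ k, edgeMatrix v' w' i.castSucc k = edgeMatrix v w i k)
    (hmerge : ∀ k, edgeMatrix v' w' v₀.castSucc k + edgeMatrix v' w' (Fin.last d) k
      = edgeMatrix v w v₀ k) (u : Fin n → ℤ) :
    (edgeMatrix v w).mulVec u = 0 ↔ (edgeMatrix v' w').mulVec u = 0 := by
  have hrow : ∀ i, i ≠ v₀ →
      (edgeMatrix v' w').mulVec u i.castSucc = (edgeMatrix v w).mulVec u i := fun i hi => by
    simp only [Matrix.mulVec, dotProduct, hne i hi]
  have hrow₀ : (edgeMatrix v' w').mulVec u v₀.castSucc + (edgeMatrix v' w').mulVec u (Fin.last d)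
      = (edgeMatrix v w).mulVec u v₀ := by
    simp only [Matrix.mulVec, dotProduct, ← Finset.sum_add_distrib, ← add_mul, hmerge]
  have hsign : ∑ i, (if c' i then (1 : ℤ) else -1) * (edgeMatrix v' w').mulVec u i = 0 := by
    simp only [Matrix.mulVec, dotProduct, Finset.mul_sum]
    rw [Finset.sum_comm]
    refine Finset.sum_eq_zero fun k _ => ?_
    simp only [← mul_assoc, ← Finset.sum_mul]
    rw [sum_sign_mul_edgeMatrix_eq_zero hc', zero_mul]
  constructor
  · intro h
    have hzero : ∀ i, i ≠ v₀ → (edgeMatrix v' w').mulVec u i.castSucc = 0 := fun i hi => by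
      rw [hrow i hi, h, Pi.zero_apply]
    rw [h, Pi.zero_apply] at hrow₀
    rw [Fin.sum_univ_castSucc, Finset.sum_eq_single v₀
      (fun i _ hi => by rw [hzero i hi, mul_zero]) (by simp)] at hsign
    have hboth : (edgeMatrix v' w').mulVec u v₀.castSucc = 0 ∧
        (edgeMatrix v' w').mulVec u (Fin.last d) = 0 := by
      cases h₁ : c' v₀.castSucc <;> cases h₂ : c' (Fin.last d) <;>
        simp [h₁, h₂] at hlast hsign <;> omega
    ext i
    induction i using Fin.lastCases with
    | last => exact hboth.2
    | cast i =>
      by_cases hi : i = v₀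
      · rw [hi]; exact hboth.1
      · exact hzero i hi
  · intro h
    ext i
    by_cases hi : i = v₀
    · rw [hi, ← hrow₀, h]; rfl
    · rw [← hrow i hi, h]; rfl

end VertexSplitting

/-- **Proposition 5.5.** Let `G` be a finite simple connected nonbipartite graph on
`{1,…,d}` whose edges are `e_k = {v k, w k}`, `k = 1,…,n`, let `K` be a field, and
suppose some vertex `v₀` of `G` lies on every odd cycle of `G`.  Then there is a
finite simple bipartite graph `G'` on `{1,…,d+1}` with exactly `n` edges
`{v' k, w' k}` such that `I_{A_G} = I_{A_{G'}}` and `I_{(A_G)^±} = I_{(A_{G'})^±}`. -/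
theorem exists_bipartite_with_same_toric_ideals (K : Type*) [Field K]
    (d n : ℕ) (G : SimpleGraph (Fin d)) (hG : G.Connected)
    (hnonbip : ¬ G.Colorable 2)
    (v w : Fin n → Fin d) (hlt : ∀ k, v k < w k)
    (hadj : ∀ k, G.Adj (v k) (w k))
    (hsurj : ∀ i j : Fin d, G.Adj i j →
      ∃ k, (v k = i ∧ w k = j) ∨ (v k = j ∧ w k = i))
    (hinj : Function.Injective fun k => (v k, w k))
    (hv₀ : ∃ v₀ : Fin d, ∀ (a : Fin d) (p : G.Walk a a),
      p.IsCycle → Odd p.length → v₀ ∈ p.support) :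
    ∃ (G' : SimpleGraph (Fin (d + 1))) (v' w' : Fin n → Fin (d + 1)),
      G'.Colorable 2 ∧
      (∀ k, v' k < w' k) ∧
      (∀ k, G'.Adj (v' k) (w' k)) ∧
      (∀ i j : Fin (d + 1), G'.Adj i j →
        ∃ k, (v' k = i ∧ w' k = j) ∨ (v' k = j ∧ w' k = i)) ∧
      (Function.Injective fun k => (v' k, w' k)) ∧
      toricIdeal K (edgeMatrix v w) = toricIdeal K (edgeMatrix v' w') ∧
      toricIdeal K (csc (edgeMatrix v w)) = toricIdeal K (csc (edgeMatrix v' w')) := by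
  obtain ⟨v₀, hv₀⟩ := hv₀
  obtain ⟨c, hc⟩ := SimpleGraph.exists_bool_coloring_away_of_mem_odd_cycles hv₀
  have hend : ∀ k, c (v k) = c (w k) → v k = v₀ ∨ w k = v₀ := fun k hk => by
    by_contra! hne
    exact hc _ _ (hadj k) hne.1 hne.2 hk
  let c' : Fin (d + 1) → Bool := Fin.lastCases (!c v₀) c
  have hc'last : c' (Fin.last d) = !c v₀ := Fin.lastCases_last
  have hc'cast : ∀ i : Fin d, c' i.castSucc = c i := fun i => Fin.lastCases_castSucc i
  let v' : Fin n → Fin (d + 1) := fun k =>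
    if c (v k) = c (w k) then (if v k = v₀ then (w k).castSucc else (v k).castSucc)
    else (v k).castSucc
  let w' : Fin n → Fin (d + 1) := fun k =>
    if c (v k) = c (w k) then Fin.last d else (w k).castSucc
  have hcol : ∀ k, c' (v' k) ≠ c' (w' k) := by
    intro k
    have := hend k
    simp only [v', w']
    split_ifs with h₁ h₂
    · rw [hc'last, hc'cast, ← h₁, h₂]; simp
    · rw [hc'last, hc'cast, h₁, (this h₁).resolve_left h₂]; simp
    · rwa [hc'cast, hc'cast]
  have hlt' : ∀ k, v' k < w' k := by
    intro k
    simp only [v', w']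
    split_ifs
    · exact Fin.castSucc_lt_last _
    · exact Fin.castSucc_lt_last _
    · exact Fin.castSucc_lt_castSucc_iff.mpr (hlt k)
  have hcases : ∀ k, (v' k = (v k).castSucc ∧ w' k = (w k).castSucc) ∨
      (v k = v₀ ∧ v' k = (w k).castSucc ∧ w' k = Fin.last d) ∨
      (w k = v₀ ∧ v' k = (v k).castSucc ∧ w' k = Fin.last d) := by
    intro k
    have := hend k
    simp only [v', w']
    split_ifs <;> simp_all
  have hinj' : Function.Injective fun k => (v' k, w' k) := by
    intro k l hkl
    obtain ⟨hv, hw⟩ := Prod.mk.inj hkl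
    have hne : ∀ i : Fin d, Fin.last d ≠ i.castSucc := fun i => (Fin.castSucc_ne_last i).symm
    apply hinj
    have hk := hlt k
    have hl := hlt l
    rcases hcases k with ⟨h₁, h₂⟩ | ⟨h, h₁, h₂⟩ | ⟨h, h₁, h₂⟩ <;>
      rcases hcases l with ⟨h₃, h₄⟩ | ⟨h', h₃, h₄⟩ | ⟨h', h₃, h₄⟩ <;>
      rw [h₁, h₃] at hv <;> rw [h₂, h₄] at hw <;>
      first
      | exact absurd hw (hne _)
      | exact absurd hw.symm (hne _)
      | (rw [Fin.castSucc_inj] at hv; rw [Prod.mk.injEq]; grind)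
  have hker : ∀ u : Fin n → ℤ,
      (edgeMatrix v w).mulVec u = 0 ↔ (edgeMatrix v' w').mulVec u = 0 := by
    refine edgeMatrix_mulVec_eq_zero_iff_of_merge (c' := c') (v₀ := v₀) hcol
      (by rw [hc'last, hc'cast]; simp) (fun i hi k => ?_) (fun k => ?_)
    · rcases hcases k with ⟨h₁, h₂⟩ | ⟨h, h₁, h₂⟩ | ⟨h, h₁, h₂⟩
      · simp [edgeMatrix, h₁, h₂]
      · simp [edgeMatrix, h₁, h₂, h, hi, add_comm]
      · simp [edgeMatrix, h₁, h₂, h, hi]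
    · have hne : ∀ i : Fin d, Fin.last d ≠ i.castSucc := fun i => (Fin.castSucc_ne_last i).symm
      rcases hcases k with ⟨h₁, h₂⟩ | ⟨h, h₁, h₂⟩ | ⟨h, h₁, h₂⟩
      · simp [edgeMatrix, h₁, h₂, hne]
      · simp [edgeMatrix, h₁, h₂, h, hne, add_comm]
      · simp [edgeMatrix, h₁, h₂, h, hne]
  let G' : SimpleGraph (Fin (d + 1)) :=
    { Adj := fun i j => ∃ k, (v' k = i ∧ w' k = j) ∨ (v' k = j ∧ w' k = i)
      symm := ⟨fun i j ⟨k, hk⟩ => ⟨k, hk.symm⟩⟩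
      loopless := ⟨fun i ⟨k, hk⟩ => (hlt' k).ne (by rcases hk with h | h <;> rw [h.1, h.2])⟩ }
  have hG' : G'.Coloring Bool := SimpleGraph.Coloring.mk c' fun {i j} ⟨k, hk⟩ => by
    rcases hk with ⟨rfl, rfl⟩ | ⟨rfl, rfl⟩
    · exact hcol k
    · exact (hcol k).symm
  exact ⟨G', v', w', by simpa using hG'.colorable, hlt', fun k => ⟨k, Or.inl ⟨rfl, rfl⟩⟩,
    fun i j h => h, hinj', toricIdeal_congr K hker, toricIdeal_csc_congr K hker⟩
end

section
/- Let A = [[2,1,0],[0,1,2]] ∈ ℤ^{2×3}, so that A^± ∈ ℤ^{3×7} has columns (0,0,1)ᵀ, (2,0,1)ᵀ, (1,1,1)ᵀ, (0,2,1)ᵀ, (−2,0,1)ᵀ, (−1,−1,1)ᵀ, (0,−2,1)ᵀ. Then the vector (1,−1,1)ᵀ belongs to ℤA^± and to ℚ_{≥0}A^±, but does not belong to ℤ_{≥0}A^±; consequently the normality condition ℤ_{≥0}A^± = ℤA^± ∩ ℚ_{≥0}A^± fails for A^±, i.e. the toric ring K[A^±] is not normal. -/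
/-- The subgroup `ℤA` of `ℤ^d` generated by the columns of an integer matrix. -/
def colLattice {d n : ℕ} (A : Matrix (Fin d) (Fin n) ℤ) : AddSubgroup (Fin d → ℤ) :=
  AddSubgroup.closure (Set.range fun j i => A i j)

/-- The submonoid `ℤ_{≥0}A` of `ℤ^d` generated by the columns of an integer matrix. -/
def colMonoid {d n : ℕ} (A : Matrix (Fin d) (Fin n) ℤ) : AddSubmonoid (Fin d → ℤ) :=
  AddSubmonoid.closure (Set.range fun j i => A i j)

/-- The set `ℚ_{≥0}A` of lattice points that are nonnegative rational combinations of
the columns of `A`. -/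
def colQNonneg {d n : ℕ} (A : Matrix (Fin d) (Fin n) ℤ) : Set (Fin d → ℤ) :=
  {x | ∃ r : Fin n → ℚ, (∀ j, 0 ≤ r j) ∧ ∀ i, (x i : ℚ) = ∑ j, r j * (A i j : ℚ)}

/-- The normality condition `ℤ_{≥0}A = ℤA ∩ ℚ_{≥0}A` for the toric ring `K[A]`. -/
def IsNormalConfig {d n : ℕ} (A : Matrix (Fin d) (Fin n) ℤ) : Prop :=
  (colMonoid A : Set (Fin d → ℤ)) = (colLattice A : Set (Fin d → ℤ)) ∩ colQNonneg A

theorem csc_example_eq :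
    csc (!![2, 1, 0; 0, 1, 2] : Matrix (Fin 2) (Fin 3) ℤ) =
      !![0, 2, 1, 0, -2, -1, 0; 0, 0, 1, 2, 0, -1, -2; 1, 1, 1, 1, 1, 1, 1] := by
  ext i j
  fin_cases i <;> fin_cases j <;> rfl

theorem column_mem_colLattice {d n : ℕ} (A : Matrix (Fin d) (Fin n) ℤ) (j : Fin n) :
    (fun i => A i j) ∈ colLattice A :=
  AddSubgroup.subset_closure (Set.mem_range_self j)

theorem mem_colLattice_csc_example :
    (![1, -1, 1] : Fin (2 + 1) → ℤ) ∈
      colLattice (csc (!![2, 1, 0; 0, 1, 2] : Matrix (Fin 2) (Fin 3) ℤ)) := by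
  have h := sub_mem (add_mem (column_mem_colLattice (csc !![2, 1, 0; 0, 1, 2]) 2)
    (column_mem_colLattice _ 6)) (column_mem_colLattice _ 0)
  rw [csc_example_eq] at h ⊢
  convert h using 1
  ext i
  fin_cases i <;> simp

theorem mem_colQNonneg_csc_example :
    (![1, -1, 1] : Fin (2 + 1) → ℤ) ∈
      colQNonneg (csc (!![2, 1, 0; 0, 1, 2] : Matrix (Fin 2) (Fin 3) ℤ)) := by
  rw [csc_example_eq]
  refine ⟨![0, 1 / 2, 0, 0, 0, 0, 1 / 2], fun j => ?_, fun i => ?_⟩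
  · fin_cases j <;> simp
  · fin_cases i <;> norm_num [Fin.sum_univ_succ]

/-- The last coordinate grades the monoid, and `(1, -1)` does not occur in degree one. -/
theorem notMem_colMonoid_csc_example :
    (![1, -1, 1] : Fin (2 + 1) → ℤ) ∉
      colMonoid (csc (!![2, 1, 0; 0, 1, 2] : Matrix (Fin 2) (Fin 3) ℤ)) := by
  rw [csc_example_eq, colMonoid]
  intro h
  have key : ∀ x ∈ AddSubmonoid.closure (Set.range fun (j : Fin (2 * 3 + 1)) i =>
      (!![0, 2, 1, 0, -2, -1, 0; 0, 0, 1, 2, 0, -1, -2; 1, 1, 1, 1, 1, 1, 1] :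
        Matrix (Fin (2 + 1)) (Fin (2 * 3 + 1)) ℤ) i j),
      0 ≤ x 2 ∧ (x 2 = 0 → x 0 = 0 ∧ x 1 = 0) ∧ (x 2 = 1 → ¬ (x 0 = 1 ∧ x 1 = -1)) := by
    intro x hx
    induction hx using AddSubmonoid.closure_induction with
    | mem x hx =>
      obtain ⟨j, rfl⟩ := hx
      fin_cases j <;> decide
    | zero => simp
    | add x y _ _ hx hy =>
      simp only [Pi.add_apply]
      omega
  exact (key _ h).2.2 rfl ⟨rfl, rfl⟩

/-- **Example 2.8.** For `A = [[2,1,0],[0,1,2]] ∈ ℤ^{2×3}`, the vector `(1,−1,1)ᵀ`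
belongs to `ℤA^±` and to `ℚ_{≥0}A^±` but not to `ℤ_{≥0}A^±`; hence the normality
condition fails for `A^±`, i.e. the toric ring `K[A^±]` is not normal. -/
theorem example_csc_not_normal :
    (![1, -1, 1] : Fin (2 + 1) → ℤ) ∈
      colLattice (csc (!![2, 1, 0; 0, 1, 2] : Matrix (Fin 2) (Fin 3) ℤ)) ∧
    (![1, -1, 1] : Fin (2 + 1) → ℤ) ∈
      colQNonneg (csc (!![2, 1, 0; 0, 1, 2] : Matrix (Fin 2) (Fin 3) ℤ)) ∧
    (![1, -1, 1] : Fin (2 + 1) → ℤ) ∉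
      colMonoid (csc (!![2, 1, 0; 0, 1, 2] : Matrix (Fin 2) (Fin 3) ℤ)) ∧
    ¬ IsNormalConfig (csc (!![2, 1, 0; 0, 1, 2] : Matrix (Fin 2) (Fin 3) ℤ)) := by
  exact ⟨mem_colLattice_csc_example, mem_colQNonneg_csc_example, notMem_colMonoid_csc_example,
    fun h => notMem_colMonoid_csc_example
      (h.ge ⟨mem_colLattice_csc_example, mem_colQNonneg_csc_example⟩)⟩
end
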